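/- Under the featured correlated Gaussian Wigner model G(n,d,ρ,r), for any two distinct bijections π1, π2 with d(π*,π1) = d(π*,π2) = 2 and d(π1,π2) = 3, the probability that the similarity score S fails to separate π* from both π1 and π2 satisfies P[ S_{π*}(G1,G2) ≤ S_{π1}(G1,G2) and S_{π*}(G1,G2) ≤ S_{π2}(G1,G2) ] ≤ (1−ρ²)^{3(n−2)/4} · (1−r²)^{3d/4}. -/

import Mathlib

open MeasureTheory ProbabilityTheory Filter
open scoped ENNReal

namespace FCGW

/-- `phi x = x / (1 - x^2)`, the weight function `φ` from the paper. -/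
noncomputable def phi (x : ℝ) : ℝ := x / (1 - x ^ 2)

/-- The edge set of the complete graph on `Fin n`: non-diagonal unordered pairs. -/
abbrev Edge (n : ℕ) := {e : Sym2 (Fin n) // ¬ e.IsDiag}

lemma map_not_isDiag {n : ℕ} (π : Equiv.Perm (Fin n)) (e : Sym2 (Fin n)) :
    ¬ e.IsDiag → ¬ (Sym2.map π e).IsDiag := by
  induction e using Sym2.ind with
  | _ x y =>
    simp only [Sym2.map_pair_eq, Sym2.mk_isDiag_iff]
    exact fun he h => he (π.injective h)

/-- Action of a vertex permutation on edges: `π({u,v}) = {π(u), π(v)}`. -/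
def edgeMap {n : ℕ} (π : Equiv.Perm (Fin n)) (e : Edge n) : Edge n :=
  ⟨Sym2.map π e.1, map_not_isDiag π e.1 e.2⟩

/-- The observation space: edge weights of `G1`, edge weights of `G2`,
features of `G1`, features of `G2`. -/
abbrev Obs (n d : ℕ) :=
  (Edge n → ℝ) × (Edge n → ℝ) × (Fin n → Fin d → ℝ) × (Fin n → Fin d → ℝ)

/-- The law of a pair of jointly Gaussian standard normals with correlation `ρ`,
i.e. a centered Gaussian vector in `ℝ²` with covariance `[[1, ρ], [ρ, 1]]`. -/
noncomputable def gaussianPair (ρ : ℝ) : Measure (ℝ × ℝ) :=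
  Measure.map (fun z : ℝ × ℝ => (z.1, ρ * z.1 + Real.sqrt (1 - ρ ^ 2) * z.2))
    ((gaussianReal 0 1).prod (gaussianReal 0 1))

/-- The law `N(0, Σ_d)` with `Σ_d = [[I_d, r I_d], [r I_d, I_d]]` of a correlated
feature pair `(x, y) ∈ ℝ^d × ℝ^d`. -/
noncomputable def featurePair (d : ℕ) (r : ℝ) : Measure ((Fin d → ℝ) × (Fin d → ℝ)) :=
  Measure.map (fun z : (Fin d → ℝ) × (Fin d → ℝ) =>
      (z.1, fun i => r * z.1 i + Real.sqrt (1 - r ^ 2) * z.2 i))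
    ((Measure.pi fun _ : Fin d => gaussianReal 0 1).prod
      (Measure.pi fun _ : Fin d => gaussianReal 0 1))

/-- The underlying randomness of the featured correlated Gaussian Wigner model:
independent correlated Gaussian pairs for each edge of `G1` and independent
correlated feature pairs for each vertex of `G1`. -/
noncomputable def sample (n d : ℕ) (ρ r : ℝ) :
    Measure ((Edge n → ℝ × ℝ) × (Fin n → (Fin d → ℝ) × (Fin d → ℝ))) :=
  (Measure.pi fun _ : Edge n => gaussianPair ρ).prod
    (Measure.pi fun _ : Fin n => featurePair d r)

/-- The observations `(β(G1), β(G2), x, y)` produced from the underlying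
randomness when the latent vertex correspondence is `πs`: the pair at edge `e`
gives the weight of `e` in `G1` and of `πs(e)` in `G2`, and the feature pair at a
vertex `v` gives the feature of `v` in `G1` and of `πs(v)` in `G2`. -/
noncomputable def obsOf {n d : ℕ} (πs : Equiv.Perm (Fin n))
    (ω : (Edge n → ℝ × ℝ) × (Fin n → (Fin d → ℝ) × (Fin d → ℝ))) : Obs n d :=
  (fun e => (ω.1 e).1,
   fun f => (ω.1 (edgeMap πs⁻¹ f)).2,
   fun v => (ω.2 v).1,
   fun v => (ω.2 (πs⁻¹ v)).2)

/-- The law of the observed pair of featured graphs `(G1, G2)` under the featured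
correlated Gaussian Wigner model `G(n, d, ρ, r)` with latent correspondence `πs`. -/
noncomputable def obsLaw (n d : ℕ) (ρ r : ℝ) (πs : Equiv.Perm (Fin n)) :
    Measure (Obs n d) :=
  Measure.map (obsOf πs) (sample n d ρ r)

/-- The similarity score
`S_π = φ(ρ) Σ_e β_e(G1) β_{π(e)}(G2) + φ(r) Σ_v ⟪x_v, y_{π(v)}⟫`. -/
noncomputable def score {n d : ℕ} (ρ r : ℝ) (o : Obs n d) (π : Equiv.Perm (Fin n)) : ℝ :=
  phi ρ * ∑ e : Edge n, o.1 e * o.2.1 (edgeMap π e)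
    + phi r * ∑ v : Fin n, ∑ i : Fin d, o.2.2.1 v i * o.2.2.2 (π v) i

/-- `overlap(π, π') = |{v : π v = π' v}| / n`. -/
noncomputable def overlap {n : ℕ} (π π' : Equiv.Perm (Fin n)) : ℝ :=
  ((Finset.univ.filter fun v => π v = π' v).card : ℝ) / n

/-- The Hamming distance `d(π, π') = |{v : π v ≠ π' v}|`. -/
def hamming {n : ℕ} (π π' : Equiv.Perm (Fin n)) : ℕ :=
  (Finset.univ.filter fun v => π v ≠ π' v).card

instance {n : ℕ} : MeasurableSpace (Equiv.Perm (Fin n)) := ⊤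

/-- The Bayesian joint law of `(π*, (G1, G2))` when `π*` is uniform on `S_n`. -/
noncomputable def bayesLaw (n d : ℕ) (ρ r : ℝ) :
    Measure (Equiv.Perm (Fin n) × Obs n d) :=
  (Nat.factorial n : ℝ≥0∞)⁻¹ •
    ∑ π : Equiv.Perm (Fin n), Measure.map (fun o => (π, o)) (obsLaw n d ρ r π)


/-! ### Gaussian integrals -/

lemma gauss_int (α β γ : ℝ) (hα : α < 1 / 2) :
    ∫⁻ x, ENNReal.ofReal (Real.exp (α * x ^ 2 + β * x + γ)) ∂(gaussianReal 0 1)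
      = ENNReal.ofReal (√(1 - 2 * α)⁻¹ * Real.exp (γ + β ^ 2 / (2 * (1 - 2 * α)))) := by
  have hp : 0 < 1 - 2 * α := by linarith
  set v : NNReal := ⟨(1 - 2 * α)⁻¹, by positivity⟩ with hv
  have hvr : (v : ℝ) = (1 - 2 * α)⁻¹ := rfl
  have hv0 : v ≠ 0 := by
    intro h
    have : (v : ℝ) = 0 := by rw [h]; rfl
    rw [hvr] at this
    exact absurd this (by positivity)
  rw [gaussianReal_of_var_ne_zero 0 one_ne_zero,
    lintegral_withDensity_eq_lintegral_mul _ (measurable_gaussianPDF 0 1) (by fun_prop)]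
  have key : ∀ x : ℝ, (gaussianPDF 0 1 * fun x => ENNReal.ofReal (Real.exp (α * x ^ 2 + β * x + γ))) x
      = ENNReal.ofReal (√(1 - 2 * α)⁻¹ * Real.exp (γ + β ^ 2 / (2 * (1 - 2 * α))))
        * gaussianPDF (β * (1 - 2 * α)⁻¹) v x := by
    intro x
    simp only [Pi.mul_apply, gaussianPDF, gaussianPDFReal_def]
    rw [← ENNReal.ofReal_mul (by positivity), ← ENNReal.ofReal_mul (by positivity)]
    congr 1
    have e1 : √(2 * Real.pi * (v : ℝ)) = √(2 * Real.pi) * √(1 - 2 * α)⁻¹ := by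
      rw [hvr, Real.sqrt_mul (by positivity)]
    rw [e1, hvr]
    have h2 : √(1 - 2 * α)⁻¹ ≠ 0 := by positivity
    have h3 : √(2 * Real.pi) ≠ 0 := by positivity
    have e2 : √(1 - 2 * α)⁻¹ * Real.exp (γ + β ^ 2 / (2 * (1 - 2 * α))) *
        ((√(2 * Real.pi) * √(1 - 2 * α)⁻¹)⁻¹ * Real.exp (-(x - β * (1 - 2 * α)⁻¹) ^ 2 / (2 * (1 - 2 * α)⁻¹)))
        = (√(2 * Real.pi))⁻¹ * (Real.exp (γ + β ^ 2 / (2 * (1 - 2 * α))) *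
          Real.exp (-(x - β * (1 - 2 * α)⁻¹) ^ 2 / (2 * (1 - 2 * α)⁻¹))) := by
      field_simp
    rw [e2, ← Real.exp_add]
    simp only [NNReal.coe_one, mul_one, sub_zero]
    rw [mul_assoc, ← Real.exp_add]
    congr 2
    have := hp.ne'
    field_simp
    ring
  simp_rw [key]
  rw [lintegral_const_mul _ (measurable_gaussianPDF _ _), lintegral_gaussianPDF_eq_one _ hv0, mul_one]

/-- Quadratic in one variable inside iterated integrals, in a convenient form. -/
lemma gauss_int' (f : ℝ → ℝ) (C α β γ : ℝ) (hC : 0 ≤ C) (hα : α < 1 / 2)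
    (hf : ∀ x, f x = α * x ^ 2 + β * x + γ) :
    ∫⁻ x, ENNReal.ofReal (C * Real.exp (f x)) ∂(gaussianReal 0 1)
      = ENNReal.ofReal (C * √(1 - 2 * α)⁻¹ * Real.exp (γ + β ^ 2 / (2 * (1 - 2 * α)))) := by
  simp_rw [hf, ENNReal.ofReal_mul hC]
  rw [lintegral_const_mul _ (by fun_prop), gauss_int _ _ _ hα, ← ENNReal.ofReal_mul hC, mul_assoc]

lemma lint3 (μ : Measure ℝ) [IsProbabilityMeasure μ] (f : (Fin 3 → ℝ) → ℝ≥0∞) (hf : Measurable f) :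
    ∫⁻ a, f a ∂(Measure.pi fun _ : Fin 3 => μ)
      = ∫⁻ z, ∫⁻ y, ∫⁻ x, f ![x, y, z] ∂μ ∂μ ∂μ := by
  have h1 := (measurePreserving_piFinSuccAbove (fun _ : Fin 3 => μ) 2).symm
  have h2 := (measurePreserving_piFinSuccAbove (fun _ : Fin 2 => μ) 1).symm
  have h3 := (measurePreserving_piFinSuccAbove (fun _ : Fin 1 => μ) 0).symm
  rw [← h1.lintegral_comp hf, lintegral_prod _ (by fun_prop)]
  refine lintegral_congr fun z => ?_
  have : (Measure.pi fun _ : Fin 2 => μ) = Measure.pi fun j : Fin 2 => (fun _ : Fin 3 => μ) ((2 : Fin 3).succAbove j) := rfl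
  rw [← this, ← h2.lintegral_comp (by fun_prop), lintegral_prod _ (by fun_prop)]
  refine lintegral_congr fun y => ?_
  have e : MeasurePreserving (MeasurableEquiv.funUnique (Fin 1) ℝ) (Measure.pi fun _ : Fin 1 => μ) μ := by
    convert measurePreserving_funUnique μ (Fin 1)
  rw [← e.symm.lintegral_comp (by fun_prop)]
  refine lintegral_congr fun x => ?_
  congr 1
  funext i
  fin_cases i <;> rfl

lemma lint_pi_prod {ι : Type*} [Fintype ι] {E : Type*} [MeasurableSpace E] (μ : Measure E)
    [IsProbabilityMeasure μ] (g : ι → E → ℝ≥0∞) (hg : ∀ i, Measurable (g i)) :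
    ∫⁻ a, ∏ i, g i (a i) ∂(Measure.pi fun _ : ι => μ) = ∏ i, ∫⁻ x, g i x ∂μ := by
  rw [lintegral_prod_eq_prod_lintegral_of_indepFun Finset.univ (fun i (a : ι → E) => g i (a i))
    (iIndepFun_pi (fun i => (hg i).aemeasurable)) (by fun_prop)]
  refine Finset.prod_congr rfl fun i _ => ?_
  exact (measurePreserving_eval (fun _ : ι => μ) i).lintegral_comp (hg i)

instance (ρ : ℝ) : IsProbabilityMeasure (gaussianPair ρ) :=
  Measure.isProbabilityMeasure_map (by fun_prop)

instance (d : ℕ) (ρ : ℝ) : IsProbabilityMeasure (featurePair d ρ) :=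
  Measure.isProbabilityMeasure_map (by fun_prop)

lemma featurePair_eq (d : ℕ) (r : ℝ) :
    (Measure.pi fun _ : Fin d => gaussianPair r).map
      (MeasurableEquiv.arrowProdEquivProdArrow ℝ ℝ (Fin d)) = featurePair d r := by
  unfold featurePair gaussianPair
  have : SigmaFinite (Measure.map (fun z : ℝ × ℝ => (z.1, r * z.1 + √(1 - r ^ 2) * z.2))
    ((gaussianReal 0 1).prod (gaussianReal 0 1))) := 
    inferInstanceAs (SigmaFinite (gaussianPair r))
  rw [← Measure.pi_map_pi (by fun_prop), ← (measurePreserving_arrowProdEquivProdArrow ℝ ℝ (Fin d)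
    (fun _ => gaussianReal 0 1) (fun _ => gaussianReal 0 1)).map_eq,
    Measure.map_map (by fun_prop) (by fun_prop), Measure.map_map (by fun_prop) (by fun_prop)]
  rfl

lemma inner_int (c ρ s : ℝ) (a L : Fin 3 → ℝ) :
    ∫⁻ z : Fin 3 → ℝ, ENNReal.ofReal (Real.exp (c * ∑ j, L j * (ρ * a j + s * z j)))
        ∂(Measure.pi fun _ : Fin 3 => gaussianReal 0 1)
      = ENNReal.ofReal (Real.exp (∑ j, (c * ρ * (L j * a j) + (c * s) ^ 2 * (L j) ^ 2 / 2))) := by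
  have h : ∀ z : Fin 3 → ℝ, ENNReal.ofReal (Real.exp (c * ∑ j, L j * (ρ * a j + s * z j)))
      = ∏ j, ENNReal.ofReal (Real.exp (0 * (z j) ^ 2 + (c * s * L j) * z j + c * ρ * (L j * a j))) := by
    intro z
    rw [← ENNReal.ofReal_prod_of_nonneg (fun _ _ => by positivity), ← Real.exp_sum, Finset.mul_sum]
    congr 3
    funext j
    ring
  simp_rw [h]
  rw [lint_pi_prod (gaussianReal 0 1)
    (fun j x => ENNReal.ofReal (Real.exp (0 * x ^ 2 + (c * s * L j) * x + c * ρ * (L j * a j))))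
    (by fun_prop)]
  simp_rw [gauss_int 0 _ _ (by norm_num)]
  rw [← ENNReal.ofReal_prod_of_nonneg (fun _ _ => by positivity), Real.exp_sum]
  congr 1
  refine Finset.prod_congr rfl fun j _ => ?_
  simp
  ring

lemma outer_int (k : ℝ) (hk : 0 ≤ k) :
    ∫⁻ a : Fin 3 → ℝ, ENNReal.ofReal (Real.exp
        (-(5 * k / 36) * (a 1 - a 2) ^ 2 - k / 12 * (2 * a 0 - a 1 - a 2) ^ 2))
        ∂(Measure.pi fun _ : Fin 3 => gaussianReal 0 1)
      = ENNReal.ofReal (√((1 + k) * (1 + 5 * k / 9))⁻¹) := by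
  rw [lint3 _ _ (by fun_prop)]
  simp only [Matrix.cons_val]
  have hA : 0 ≤ k / (4 * (3 + 2 * k)) := by positivity
  set A := k / (4 * (3 + 2 * k)) with hAdef
  have hAe : A * (4 * (3 + 2 * k)) = k := by rw [hAdef]; field_simp
  set B := 5 * k / 36 with hB
  have hB0 : 0 ≤ B := by positivity
  have i1 : ∀ z y : ℝ, ∫⁻ x, ENNReal.ofReal (Real.exp
        (-B * (y - z) ^ 2 - k / 12 * (2 * x - y - z) ^ 2)) ∂(gaussianReal 0 1)
        = ENNReal.ofReal (√(1 + 2 * k / 3)⁻¹ * Real.exp (-B * (y - z) ^ 2 - A * (y + z) ^ 2)) := by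
    intro z y
    have := gauss_int' (fun x => -B * (y - z) ^ 2 - k / 12 * (2 * x - y - z) ^ 2) 1
      (-(k / 3)) (k / 3 * (y + z)) (-B * (y - z) ^ 2 - k / 12 * (y + z) ^ 2) (by norm_num)
      (by linarith) (fun x => by ring)
    simp only [one_mul] at this
    rw [this]
    congr 3
    · congr 1; ring
    · rw [hAdef]
      have h2 : 3 + 2 * k ≠ 0 := by positivity
      have h3 : 1 - 2 * -(k / 3) = (3 + 2 * k) / 3 := by ring
      rw [h3]
      field_simp
      ring
  simp_rw [i1]
  have i2 : ∀ z : ℝ, ∫⁻ y, ENNReal.ofReal (√(1 + 2 * k / 3)⁻¹ *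
        Real.exp (-B * (y - z) ^ 2 - A * (y + z) ^ 2)) ∂(gaussianReal 0 1)
        = ENNReal.ofReal (√(1 + 2 * k / 3)⁻¹ * √(1 + 2 * (A + B))⁻¹ *
          Real.exp (-(A + B - 2 * (B - A) ^ 2 / (1 + 2 * (A + B))) * z ^ 2)) := by
    intro z
    rw [gauss_int' (fun y => -B * (y - z) ^ 2 - A * (y + z) ^ 2) _
      (-(A + B)) (2 * (B - A) * z) (-(A + B) * z ^ 2) (by positivity)
      (by linarith) (fun x => by ring)]
    have h3 : 1 - 2 * -(A + B) = 1 + 2 * (A + B) := by ring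
    rw [h3]
    congr 3
    have h1 : 1 + 2 * (A + B) ≠ 0 := by positivity
    field_simp
    ring
  simp_rw [i2]
  have hAB : 1 + 2 * (A + B) ≠ 0 := by positivity
  have hD : 1 - 2 * -(A + B - 2 * (B - A) ^ 2 / (1 + 2 * (A + B)))
      = (1 + 4 * A) * (1 + 4 * B) / (1 + 2 * (A + B)) := by
    field_simp
    ring
  have hD0 : 0 < (1 + 4 * A) * (1 + 4 * B) / (1 + 2 * (A + B)) := by positivity
  rw [gauss_int' _ _ (-(A + B - 2 * (B - A) ^ 2 / (1 + 2 * (A + B)))) 0 0 (by positivity) 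
    (by
      have hge : 1 ≤ (1 + 4 * A) * (1 + 4 * B) / (1 + 2 * (A + B)) := by
        rw [le_div_iff₀ (by positivity)]
        nlinarith [mul_nonneg hA hB0]
      linarith) (fun x => by ring), hD]
  congr 1
  simp only [ne_eq, OfNat.ofNat_ne_zero, not_false_eq_true, zero_pow, zero_div, add_zero,
    Real.exp_zero, mul_one]
  rw [← Real.sqrt_mul (by positivity), ← Real.sqrt_mul (by positivity)]
  congr 1
  have h4 : (1 + 4 * B) = 1 + 5 * k / 9 := by rw [hB]; ring
  have h5 : (1 + 2 * k / 3) * (1 + 4 * A) = 1 + k := by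
    have : (3 + 2 * k) ≠ 0 := by positivity
    rw [hAdef]; field_simp; ring
  rw [← h5, ← h4]
  field_simp

lemma block_int (ρ : ℝ) (hρ : 0 < ρ ∧ ρ < 1) :
    ∫⁻ p : Fin 3 → ℝ × ℝ, ENNReal.ofReal (Real.exp (phi ρ / 3 *
        ∑ j, (p j).1 * ((p (Equiv.swap 0 1 j)).2 + (p (Equiv.swap 0 2 j)).2 - 2 * (p j).2)))
        ∂(Measure.pi fun _ : Fin 3 => gaussianPair ρ)
      ≤ ENNReal.ofReal ((1 - ρ ^ 2) ^ (3 / 4 : ℝ)) := by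
  have hs : 0 < 1 - ρ ^ 2 := by nlinarith [hρ.1, hρ.2]
  set k := ρ ^ 2 / (1 - ρ ^ 2) with hk
  have hk0 : 0 ≤ k := by positivity
  set G : (Fin 3 → ℝ) × (Fin 3 → ℝ) → ℝ≥0∞ := fun q => ENNReal.ofReal (Real.exp (phi ρ / 3 *
        ∑ j, q.1 j * (q.2 (Equiv.swap 0 1 j) + q.2 (Equiv.swap 0 2 j) - 2 * q.2 j))) with hG
  have hGm : Measurable G := by fun_prop
  have step1 : ∫⁻ p : Fin 3 → ℝ × ℝ, ENNReal.ofReal (Real.exp (phi ρ / 3 *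
        ∑ j, (p j).1 * ((p (Equiv.swap 0 1 j)).2 + (p (Equiv.swap 0 2 j)).2 - 2 * (p j).2)))
        ∂(Measure.pi fun _ : Fin 3 => gaussianPair ρ) = ∫⁻ q, G q ∂(featurePair 3 ρ) := by
    rw [← featurePair_eq, lintegral_map hGm (by fun_prop)]
    rfl
  rw [step1]
  unfold featurePair
  rw [lintegral_map hGm (by fun_prop), lintegral_prod _ (by fun_prop)]
  have step2 : ∀ a : Fin 3 → ℝ, ∫⁻ z : Fin 3 → ℝ,
      G ((a, z).1, fun i => ρ * (a, z).1 i + √(1 - ρ ^ 2) * (a, z).2 i)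
        ∂(Measure.pi fun _ : Fin 3 => gaussianReal 0 1) =
      ENNReal.ofReal (Real.exp
        (-(5 * k / 36) * (a 1 - a 2) ^ 2 - k / 12 * (2 * a 0 - a 1 - a 2) ^ 2)) := by
    intro a
    have := inner_int (phi ρ / 3) ρ (√(1 - ρ ^ 2)) a ![a 1 + a 2 - 2 * a 0, a 0 - a 1, a 0 - a 2]
    convert this using 1
    · refine lintegral_congr fun z => ?_
      simp only [hG]
      congr 3
      have s1 : (Equiv.swap (0 : Fin 3) 1) 2 = 2 := by decide
      have s2 : (Equiv.swap (0 : Fin 3) 2) 1 = 1 := by decide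
      simp [Fin.sum_univ_three, s1, s2]
      ring
    · congr 2
      rw [Fin.sum_univ_three]
      simp only [Matrix.cons_val]
      rw [mul_pow, Real.sq_sqrt hs.le, hk, phi]
      field_simp
      ring
  simp_rw [step2]
  rw [outer_int k hk0]
  apply ENNReal.ofReal_le_ofReal
  have h1k : 1 - ρ ^ 2 = (1 + k)⁻¹ := by rw [hk]; field_simp; ring
  rw [h1k]
  have hb : (1 + k) ^ (3 / 2 : ℝ) ≤ (1 + k) * (1 + 5 * k / 9) := by
    have : (1 + k) ^ (3 / 2 : ℝ) = (1 + k) * √(1 + k) := by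
      rw [Real.sqrt_eq_rpow, show (3 / 2 : ℝ) = 1 + 1 / 2 by norm_num,
        Real.rpow_add (by positivity), Real.rpow_one]
    rw [this]
    gcongr
    rw [Real.sqrt_le_left (by positivity)]
    nlinarith
  rw [Real.sqrt_le_left (by positivity), ← Real.rpow_natCast, ← Real.rpow_mul (by positivity),
    Real.inv_rpow (by positivity)]
  gcongr
  norm_num
  exact hb

/-! ### Independence across blocks -/

lemma master {Ω κ B : Type*} [MeasurableSpace Ω] (μ : Measure Ω) [Fintype κ] [Fintype B]
    (ρ : ℝ) (hρ : 0 < ρ ∧ ρ < 1) (X : κ → Ω → ℝ × ℝ) (hX : ∀ k, Measurable (X k))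
    (hind : iIndepFun X μ) (hlaw : ∀ k, μ.map (X k) = gaussianPair ρ)
    (ι : B × Fin 3 → κ) (hι : Function.Injective ι) (s1 s2 : κ → κ)
    (hs1 : ∀ b j, s1 (ι (b, j)) = ι (b, Equiv.swap 0 1 j))
    (hs2 : ∀ b j, s2 (ι (b, j)) = ι (b, Equiv.swap 0 2 j))
    (hf1 : ∀ k, k ∉ Set.range ι → s1 k = k) (hf2 : ∀ k, k ∉ Set.range ι → s2 k = k) :
    ∫⁻ ω, ENNReal.ofReal (Real.exp (phi ρ / 3 *
      ∑ k, (X k ω).1 * ((X (s1 k) ω).2 + (X (s2 k) ω).2 - 2 * (X k ω).2))) ∂μ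
      ≤ ENNReal.ofReal ((1 - ρ ^ 2) ^ (3 / 4 : ℝ)) ^ Fintype.card B := by
  set F : (Fin 3 → ℝ × ℝ) → ℝ≥0∞ := fun p => ENNReal.ofReal (Real.exp (phi ρ / 3 *
        ∑ j, (p j).1 * ((p (Equiv.swap 0 1 j)).2 + (p (Equiv.swap 0 2 j)).2 - 2 * (p j).2))) with hF
  have hFm : Measurable F := by fun_prop
  have e1 : ∀ ω, ENNReal.ofReal (Real.exp (phi ρ / 3 *
      ∑ k, (X k ω).1 * ((X (s1 k) ω).2 + (X (s2 k) ω).2 - 2 * (X k ω).2)))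
      = ∏ b, F ((MeasurableEquiv.curry B (Fin 3) (ℝ × ℝ)) (fun p => X (ι p) ω) b) := by
    intro ω
    rw [hF, ← ENNReal.ofReal_prod_of_nonneg (fun _ _ => by positivity), ← Real.exp_sum,
      ← Finset.mul_sum]
    congr 3
    rw [← Fintype.sum_prod_type' (f := fun b j => 
      (((MeasurableEquiv.curry B (Fin 3) (ℝ × ℝ)) (fun p => X (ι p) ω) b) j).1 *
      ((((MeasurableEquiv.curry B (Fin 3) (ℝ × ℝ)) (fun p => X (ι p) ω) b) (Equiv.swap 0 1 j)).2
       + (((MeasurableEquiv.curry B (Fin 3) (ℝ × ℝ)) (fun p => X (ι p) ω) b) (Equiv.swap 0 2 j)).2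
       - 2 * (((MeasurableEquiv.curry B (Fin 3) (ℝ × ℝ)) (fun p => X (ι p) ω) b) j).2))]
    symm
    apply Fintype.sum_of_injective ι hι
    · intro k hk
      rw [hf1 k hk, hf2 k hk]
      ring
    · rintro ⟨b, j⟩
      rw [hs1, hs2]
      rfl
  simp_rw [e1]
  have hpr := hind.isProbabilityMeasure
  have hmap : μ.map (fun ω p => X (ι p) ω) = Measure.infinitePi (fun _ : B × Fin 3 => gaussianPair ρ) := by
    rw [(hind.precomp hι).map_fun_eq_infinitePi_map (fun p => hX (ι p))]
    simp_rw [hlaw]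
  have hcur := Measure.infinitePi_map_curry (fun (_ : B) (_ : Fin 3) => gaussianPair ρ)
  rw [← hmap, Measure.map_map (by fun_prop) (by fun_prop)] at hcur
  simp_rw [Measure.infinitePi_eq_pi] at hcur
  have e2 := lintegral_map (μ := μ) (f := fun q : B → Fin 3 → ℝ × ℝ => ∏ b, F (q b))
    (g := (MeasurableEquiv.curry B (Fin 3) (ℝ × ℝ)) ∘ (fun ω p => X (ι p) ω)) (by fun_prop) (by fun_prop)
  simp only [Function.comp_apply] at e2
  rw [← e2, hcur, lint_pi_prod _ (fun _ => F) (fun _ => hFm), Finset.prod_const, Finset.card_univ]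
  gcongr
  exact block_int ρ hρ

/-! ### Combinatorics -/

lemma exists_triple {n : ℕ} (σ1 σ2 : Equiv.Perm (Fin n)) (h1 : σ1.support.card = 2)
    (h2 : σ2.support.card = 2) (h12 : (Finset.univ.filter fun v => σ1 v ≠ σ2 v).card = 3) :
    ∃ p : Fin 3 → Fin n, Function.Injective p ∧ σ1 = Equiv.swap (p 0) (p 1) ∧
      σ2 = Equiv.swap (p 0) (p 2) := by
  obtain ⟨a, b, hab, rfl⟩ := Equiv.Perm.card_support_eq_two.1 h1
  obtain ⟨c, d, hcd, rfl⟩ := Equiv.Perm.card_support_eq_two.1 h2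
  have main : ∀ a b d : Fin n, a ≠ b → a ≠ d → b ≠ d →
      ∃ p : Fin 3 → Fin n, Function.Injective p ∧ Equiv.swap a b = Equiv.swap (p 0) (p 1) ∧
      Equiv.swap a d = Equiv.swap (p 0) (p 2) := by
    intro a b d hab had hbd
    refine ⟨![a, b, d], ?_, rfl, rfl⟩
    intro i j
    fin_cases i <;> fin_cases j <;> simp [hab, had, hbd, hab.symm, had.symm, hbd.symm]
  have hne : Equiv.swap a b ≠ Equiv.swap c d := by
    intro h
    rw [h] at h12
    simp at h12
  by_cases hac : a = c
  · subst hac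
    exact main a b d hab hcd (fun h => hne (by rw [h]))
  by_cases had : a = d
  · subst had
    rw [Equiv.swap_comm c a] at *
    exact main a b c hab hac (fun h => hne (by rw [h]))
  by_cases hbc : b = c
  · subst hbc
    rw [Equiv.swap_comm a b] at *
    exact main b a d hab.symm hcd had
  by_cases hbd : b = d
  · subst hbd
    rw [Equiv.swap_comm a b, Equiv.swap_comm c b] at *
    exact main b a c hab.symm hcd.symm hac
  exfalso
  have hsub : ({a, b, c, d} : Finset (Fin n)) ⊆
      Finset.univ.filter fun v => Equiv.swap a b v ≠ Equiv.swap c d v := by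
    intro x hx
    simp only [Finset.mem_insert, Finset.mem_singleton] at hx
    simp only [Finset.mem_filter, Finset.mem_univ, true_and]
    rcases hx with rfl | rfl | rfl | rfl
    · rw [Equiv.swap_apply_left, Equiv.swap_apply_of_ne_of_ne hac had]; exact hab.symm
    · rw [Equiv.swap_apply_right, Equiv.swap_apply_of_ne_of_ne hbc hbd]; exact hab
    · rw [Equiv.swap_apply_left, Equiv.swap_apply_of_ne_of_ne (Ne.symm hac) (Ne.symm hbc)]; exact hcd
    · rw [Equiv.swap_apply_right, Equiv.swap_apply_of_ne_of_ne (Ne.symm had) (Ne.symm hbd)]; exact hcd.symm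
  have := Finset.card_le_card hsub
  rw [h12] at this
  have h4 : ({a, b, c, d} : Finset (Fin n)).card = 4 := by
    rw [Finset.card_insert_of_notMem (by simp [hab, hac, had]),
      Finset.card_insert_of_notMem (by simp [hbc, hbd]), Finset.card_pair hcd]
  omega

/-- The three-edge blocks. -/
def blk {n : ℕ} (p : Fin 3 → Fin n) (hp : Function.Injective p) :
    Option {x : Fin n // ∀ j, x ≠ p j} × Fin 3 → Edge n
  | (none, j) => ⟨s(p (j + 1), p (j + 2)), by
      rw [Sym2.mk_isDiag_iff, hp.eq_iff]; revert j; decide⟩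
  | (some x, j) => ⟨s(x.1, p j), by
      rw [Sym2.mk_isDiag_iff]; exact x.2 j⟩

lemma blk_inj {n : ℕ} (p : Fin 3 → Fin n) (hp : Function.Injective p) :
    Function.Injective (blk p hp) := by
  rintro ⟨_ | x, i⟩ ⟨_ | y, j⟩ h
  · simp only [blk, Subtype.mk.injEq, Sym2.eq_iff, hp.eq_iff] at h
    have : i = j := by revert i j; decide
    rw [this]
  · simp only [blk, Subtype.mk.injEq, Sym2.eq_iff, hp.eq_iff] at h
    rcases h with h | h
    · exact absurd h.1.symm (y.2 _)
    · exact absurd h.2.symm (y.2 _)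
  · simp only [blk, Subtype.mk.injEq, Sym2.eq_iff, hp.eq_iff] at h
    rcases h with h | h
    · exact absurd h.1 (x.2 _)
    · exact absurd h.1 (x.2 _)
  · simp only [blk, Subtype.mk.injEq, Sym2.eq_iff, hp.eq_iff] at h
    rcases h with h | h
    · rw [Subtype.ext h.1, h.2]
    · exact absurd h.1 (x.2 _)

lemma blk_swap {n : ℕ} (p : Fin 3 → Fin n) (hp : Function.Injective p) (a : Fin 3)
    (b : Option {x : Fin n // ∀ j, x ≠ p j}) (j : Fin 3) :
    edgeMap (Equiv.swap (p 0) (p a)) (blk p hp (b, j)) = blk p hp (b, Equiv.swap 0 a j) := by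
  have hsw : ∀ i, Equiv.swap (p 0) (p a) (p i) = p (Equiv.swap 0 a i) :=
    fun i => (hp.map_swap 0 a i).symm
  rcases b with _ | x
  · simp only [edgeMap, blk, Sym2.map_mk, hsw, Subtype.mk.injEq, Sym2.eq_iff, hp.eq_iff]
    clear hsw
    revert a j; decide
  · simp only [edgeMap, blk, Sym2.map_mk, hsw, Equiv.swap_apply_of_ne_of_ne (x.2 0) (x.2 a)]

lemma blk_fix {n : ℕ} (p : Fin 3 → Fin n) (hp : Function.Injective p) (a : Fin 3)
    (e : Edge n) (he : e ∉ Set.range (blk p hp)) :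
    edgeMap (Equiv.swap (p 0) (p a)) e = e := by
  obtain ⟨e, hd⟩ := e
  induction e using Sym2.ind with
  | _ x y =>
    have hxy : x ≠ y := by simpa using hd
    have key : ∀ x y (hd : ¬ Sym2.IsDiag s(x, y)) (_ : x ≠ y),
        (⟨s(x, y), hd⟩ : Edge n) ∉ Set.range (blk p hp) → ∀ j, x ≠ p j := by
      rintro x y hd hxy hr i rfl
      apply hr
      by_cases hy : ∃ j, y = p j
      · obtain ⟨j, rfl⟩ := hy
        have hij : i ≠ j := fun h => hxy (by rw [h])
        have : ∃ k : Fin 3, (k + 1 = i ∧ k + 2 = j) ∨ (k + 1 = j ∧ k + 2 = i) := by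
          clear hr hxy hd
          revert i j; decide
        obtain ⟨k, hk⟩ := this
        refine ⟨(none, k), ?_⟩
        simp only [blk, Subtype.mk.injEq, Sym2.eq_iff, hp.eq_iff]
        exact hk
      · push Not at hy
        refine ⟨(some ⟨y, hy⟩, i), ?_⟩
        simp only [blk, Subtype.mk.injEq, Sym2.eq_iff]
        tauto
    have hx := key x y hd hxy he
    have hy := key y x (by simpa using hxy.symm) hxy.symm (by
      have : (⟨s(y, x), by simpa using hxy.symm⟩ : Edge n) = ⟨s(x, y), hd⟩ := by
        simp [Sym2.eq_swap]
      rw [this]; exact he)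
    simp only [edgeMap, Sym2.map_mk, Equiv.swap_apply_of_ne_of_ne (hx 0) (hx a),
      Equiv.swap_apply_of_ne_of_ne (hy 0) (hy a)]

lemma card_blk {n : ℕ} (p : Fin 3 → Fin n) (hp : Function.Injective p) :
    (Fintype.card (Option {x : Fin n // ∀ j, x ≠ p j}) : ℝ) = (n : ℝ) - 2 := by
  have h : Fintype.card {x : Fin n // ∀ j, x ≠ p j} + 3 = n := by
    rw [Fintype.card_subtype]
    have h3 : (Finset.univ.image p).card = 3 := by
      rw [Finset.card_image_of_injective _ hp]; simp
    have : (Finset.univ.filter fun x => ∀ j, x ≠ p j) = (Finset.univ.image p)ᶜ := by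
      ext x; simp [eq_comm]
    rw [this]
    have := Finset.card_compl_add_card (Finset.univ.image p)
    rw [h3, Fintype.card_fin] at this
    exact this
  rw [Fintype.card_option]
  have h' : (Fintype.card {x : Fin n // ∀ j, x ≠ p j} : ℝ) + 3 = n := by exact_mod_cast h
  push_cast
  linarith

lemma ofReal_rpow_pow (t : ℝ) (ht : 0 < t) (N : ℕ) :
    ENNReal.ofReal (t ^ (3 / 4 : ℝ)) ^ N = ENNReal.ofReal (t ^ (3 * (N : ℝ) / 4)) := by
  rw [← ENNReal.ofReal_pow (by positivity), ← Real.rpow_natCast, ← Real.rpow_mul ht.le]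
  congr 2
  ring

lemma edges_bound (n : ℕ) (ρ : ℝ) (hρ : 0 < ρ ∧ ρ < 1) (p : Fin 3 → Fin n)
    (hp : Function.Injective p) :
    ∫⁻ ω : Edge n → ℝ × ℝ, ENNReal.ofReal (Real.exp (phi ρ / 3 *
      ∑ e, (ω e).1 * ((ω (edgeMap (Equiv.swap (p 0) (p 1)) e)).2
        + (ω (edgeMap (Equiv.swap (p 0) (p 2)) e)).2 - 2 * (ω e).2)))
        ∂(Measure.pi fun _ : Edge n => gaussianPair ρ)
      ≤ ENNReal.ofReal ((1 - ρ ^ 2) ^ (3 * ((n : ℝ) - 2) / 4)) := by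
  have hs : 0 < 1 - ρ ^ 2 := by nlinarith [hρ.1, hρ.2]
  have := master (Measure.pi fun _ : Edge n => gaussianPair ρ) ρ hρ (fun e ω => ω e)
    (fun e => measurable_pi_apply e)
    (iIndepFun_pi (X := fun _ x => x) (fun _ => aemeasurable_id))
    (fun e => (measurePreserving_eval (fun _ : Edge n => gaussianPair ρ) e).map_eq)
    (blk p hp) (blk_inj p hp) _ _ (blk_swap p hp 1) (blk_swap p hp 2) (blk_fix p hp 1)
    (blk_fix p hp 2)
  rw [ofReal_rpow_pow _ hs, card_blk p hp] at this
  exact this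

lemma features_bound (n d : ℕ) (r : ℝ) (hr : 0 < r ∧ r < 1) (p : Fin 3 → Fin n)
    (hp : Function.Injective p) :
    ∫⁻ ω : Fin n → (Fin d → ℝ) × (Fin d → ℝ), ENNReal.ofReal (Real.exp (phi r / 3 *
      ∑ v, ∑ i, (ω v).1 i * ((ω (Equiv.swap (p 0) (p 1) v)).2 i
        + (ω (Equiv.swap (p 0) (p 2) v)).2 i - 2 * (ω v).2 i)))
        ∂(Measure.pi fun _ : Fin n => featurePair d r)
      ≤ ENNReal.ofReal ((1 - r ^ 2) ^ (3 * (d : ℝ) / 4)) := by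
  have hs : 0 < 1 - r ^ 2 := by nlinarith [hr.1, hr.2]
  have hfp : (Measure.pi fun _ : Fin n => featurePair d r) =
      (Measure.pi fun _ : Fin n => Measure.pi fun _ : Fin d => gaussianPair r).map
        (fun ω v => MeasurableEquiv.arrowProdEquivProdArrow ℝ ℝ (Fin d) (ω v)) := by
    have : ∀ _ : Fin n, SigmaFinite ((Measure.pi fun _ : Fin d => gaussianPair r).map
      (MeasurableEquiv.arrowProdEquivProdArrow ℝ ℝ (Fin d))) := by
        intro _; rw [featurePair_eq]; infer_instance
    rw [Measure.pi_map_pi (f := fun _ => MeasurableEquiv.arrowProdEquivProdArrow ℝ ℝ (Fin d))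
      (by fun_prop)]
    simp_rw [featurePair_eq]
  rw [hfp, lintegral_map (by fun_prop) (by fun_prop)]
  have hsw : ∀ (a : Fin 3) i, Equiv.swap (p 0) (p a) (p i) = p (Equiv.swap 0 a i) :=
    fun a i => (hp.map_swap 0 a i).symm
  have hfix : ∀ (a : Fin 3) (k : Fin n × Fin d),
      k ∉ Set.range (fun q : Fin d × Fin 3 => (p q.2, q.1)) →
      ((Equiv.swap (p 0) (p a) k.1, k.2) : Fin n × Fin d) = k := by
    rintro a ⟨v, i⟩ hk
    have hv : ∀ j, v ≠ p j := fun j h => hk ⟨(i, j), by rw [h]⟩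
    simp only [Equiv.swap_apply_of_ne_of_ne (hv 0) (hv a)]
  have hind := iIndepFun_uncurry_infinitePi' (X := fun (_ : Fin n) (_ : Fin d) (x : ℝ × ℝ) => x)
    (fun (_ : Fin n) (_ : Fin d) => gaussianPair r) (fun _ _ => measurable_id)
  simp_rw [Measure.infinitePi_eq_pi] at hind
  have := master (Measure.pi fun _ : Fin n => Measure.pi fun _ : Fin d => gaussianPair r) r hr
    (fun (k : Fin n × Fin d) ω => ω k.1 k.2) (fun k => by fun_prop) hind
    (fun k => by
      have h1 := measurePreserving_eval (fun _ : Fin n => Measure.pi fun _ : Fin d => gaussianPair r) k.1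
      have h2 := measurePreserving_eval (fun _ : Fin d => gaussianPair r) k.2
      exact (h2.comp h1).map_eq)
    (fun q : Fin d × Fin 3 => (p q.2, q.1))
    (by
      rintro ⟨i, j⟩ ⟨i', j'⟩ h
      simp only [Prod.mk.injEq, hp.eq_iff] at h
      rw [h.1, h.2])
    (fun k => (Equiv.swap (p 0) (p 1) k.1, k.2)) (fun k => (Equiv.swap (p 0) (p 2) k.1, k.2))
    (fun b j => by simp only [hsw]) (fun b j => by simp only [hsw]) (hfix 1) (hfix 2)
  rw [ofReal_rpow_pow _ hs, Fintype.card_fin] at this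
  simp_rw [Fintype.sum_prod_type] at this
  exact this

lemma edgeMap_mul {n : ℕ} (π π' : Equiv.Perm (Fin n)) (e : Edge n) :
    edgeMap π (edgeMap π' e) = edgeMap (π * π') e := by
  simp [edgeMap, Sym2.map_map, Equiv.Perm.coe_mul]

lemma edgeMap_one {n : ℕ} (e : Edge n) : edgeMap (1 : Equiv.Perm (Fin n)) e = e := by
  simp [edgeMap]

lemma score_obs {n d : ℕ} (ρ r : ℝ) (πs π : Equiv.Perm (Fin n))
    (ω : (Edge n → ℝ × ℝ) × (Fin n → (Fin d → ℝ) × (Fin d → ℝ))) :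
    score ρ r (obsOf πs ω) π = phi ρ * ∑ e, (ω.1 e).1 * (ω.1 (edgeMap (πs⁻¹ * π) e)).2
      + phi r * ∑ v, ∑ i, (ω.2 v).1 i * (ω.2 ((πs⁻¹ * π) v)).2 i := by
  simp only [score, obsOf, edgeMap_mul, Equiv.Perm.mul_apply]

lemma measurable_obsOf {n d : ℕ} (πs : Equiv.Perm (Fin n)) :
    Measurable (obsOf (d := d) πs) := by
  unfold obsOf
  fun_prop

lemma measurable_score {n d : ℕ} (ρ r : ℝ) (π : Equiv.Perm (Fin n)) :
    Measurable (fun o : Obs n d => score ρ r o π) := by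
  unfold score
  fun_prop

/-- Lemma: joint failure probability for two permutations at
distance 2 from `π*` and distance 3 from one another.
`P[S_{π*} ≤ S_{π₁} ∧ S_{π*} ≤ S_{π₂}] ≤ (1-ρ²)^{3(n-2)/4} (1-r²)^{3d/4}`. -/
theorem joint_failure_bound
    (n d : ℕ) (ρ r : ℝ) (hρ : 0 < ρ ∧ ρ < 1) (hr : 0 < r ∧ r < 1)
    (πs π1 π2 : Equiv.Perm (Fin n)) (hne : π1 ≠ π2)
    (h1 : hamming πs π1 = 2) (h2 : hamming πs π2 = 2) (h12 : hamming π1 π2 = 3) :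
    obsLaw n d ρ r πs
        {o : Obs n d | score ρ r o πs ≤ score ρ r o π1 ∧ score ρ r o πs ≤ score ρ r o π2}
      ≤ ENNReal.ofReal
          ((1 - ρ ^ 2) ^ (3 * ((n : ℝ) - 2) / 4) * (1 - r ^ 2) ^ (3 * (d : ℝ) / 4)) := by

  have hhs : ∀ π π' : Equiv.Perm (Fin n), hamming π π' =
      (Finset.univ.filter fun v => (πs⁻¹ * π) v ≠ (πs⁻¹ * π') v).card := by
    intro π π'
    unfold hamming
    congr 1
    ext v
    simp
  have hsupp : ∀ π : Equiv.Perm (Fin n), hamming πs π = 2 → (πs⁻¹ * π).support.card = 2 := by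
    intro π h
    rw [hhs] at h
    rw [← h]
    congr 1
    ext v
    simp only [Equiv.Perm.mem_support, Finset.mem_filter, Finset.mem_univ, true_and,
      inv_mul_cancel, Equiv.Perm.coe_one, id_eq]
    exact ne_comm
  obtain ⟨p, hp, hσ1, hσ2⟩ := exists_triple (πs⁻¹ * π1) (πs⁻¹ * π2) (hsupp π1 h1) (hsupp π2 h2)
    (by rw [← hhs]; exact h12)
  have hm : MeasurableSet {o : Obs n d | score ρ r o πs ≤ score ρ r o π1 ∧
      score ρ r o πs ≤ score ρ r o π2} :=
    (measurableSet_le (measurable_score ρ r πs) (measurable_score ρ r π1)).inter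
      (measurableSet_le (measurable_score ρ r πs) (measurable_score ρ r π2))
  rw [obsLaw, Measure.map_apply (measurable_obsOf πs) hm]
  set f : (Edge n → ℝ × ℝ) → ℝ≥0∞ := fun ω => ENNReal.ofReal (Real.exp (phi ρ / 3 *
      ∑ e, (ω e).1 * ((ω (edgeMap (Equiv.swap (p 0) (p 1)) e)).2
        + (ω (edgeMap (Equiv.swap (p 0) (p 2)) e)).2 - 2 * (ω e).2))) with hf
  set g : (Fin n → (Fin d → ℝ) × (Fin d → ℝ)) → ℝ≥0∞ := fun ω =>
    ENNReal.ofReal (Real.exp (phi r / 3 *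
      ∑ v, ∑ i, (ω v).1 i * ((ω (Equiv.swap (p 0) (p 1) v)).2 i
        + (ω (Equiv.swap (p 0) (p 2) v)).2 i - 2 * (ω v).2 i))) with hg
  have hfm : Measurable f := by fun_prop
  have hgm : Measurable g := by fun_prop
  have hs : 0 < 1 - ρ ^ 2 := by nlinarith [hρ.1, hρ.2]
  have hle : ∀ ω : (Edge n → ℝ × ℝ) × (Fin n → (Fin d → ℝ) × (Fin d → ℝ)),
      (obsOf πs ⁻¹' {o : Obs n d | score ρ r o πs ≤ score ρ r o π1 ∧
        score ρ r o πs ≤ score ρ r o π2}).indicator 1 ω ≤ f ω.1 * g ω.2 := by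
    intro ω
    by_cases hω : ω ∈ (obsOf πs ⁻¹' {o : Obs n d | score ρ r o πs ≤ score ρ r o π1 ∧
        score ρ r o πs ≤ score ρ r o π2})
    · rw [Set.indicator_of_mem hω, Pi.one_apply]
      obtain ⟨ha, hb⟩ := hω
      rw [score_obs, score_obs, hσ1, inv_mul_cancel] at ha
      rw [score_obs, score_obs, hσ2, inv_mul_cancel] at hb
      simp only [edgeMap_one, Equiv.Perm.coe_one, id_eq] at ha hb
      rw [hf, hg]
      dsimp only
      rw [← ENNReal.ofReal_mul (by positivity), ← Real.exp_add, ENNReal.one_le_ofReal,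
        Real.one_le_exp_iff]
      simp only [mul_sub, mul_add, Finset.sum_sub_distrib, Finset.sum_add_distrib,
        mul_left_comm _ (2 : ℝ), ← Finset.mul_sum]
      linarith
    · rw [Set.indicator_of_notMem hω]
      exact zero_le
  calc _ = ∫⁻ ω, (obsOf πs ⁻¹' {o : Obs n d | score ρ r o πs ≤ score ρ r o π1 ∧
        score ρ r o πs ≤ score ρ r o π2}).indicator 1 ω ∂(sample n d ρ r) := by
        rw [lintegral_indicator_one (measurable_obsOf πs hm)]
    _ ≤ ∫⁻ ω, f ω.1 * g ω.2 ∂(sample n d ρ r) := lintegral_mono hle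
    _ = (∫⁻ ω, f ω ∂(Measure.pi fun _ : Edge n => gaussianPair ρ)) *
        ∫⁻ ω, g ω ∂(Measure.pi fun _ : Fin n => featurePair d r) := by
        rw [sample, lintegral_prod_mul hfm.aemeasurable hgm.aemeasurable]
    _ ≤ _ := by
        rw [ENNReal.ofReal_mul (by positivity)]
        gcongr
        · exact edges_bound n ρ hρ p hp
        · exact features_bound n d r hr p hp

end FCGW
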